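/- arXiv:1903.05494 — 3 statements merged into one kernel-verified Lean document; each statement's English description precedes it below -/
import Mathlib

section
/- Let C = [C_1, C_2, ..., C_s]A be a matrix-product code where A ∈ F_q^{s×s} is an invertible square matrix, and let J be the s×s anti-diagonal permutation matrix with 1's on the anti-diagonal and 0's elsewhere. Then the dual code satisfies C^⊥ = [C_s^⊥, C_{s-1}^⊥, ..., C_1^⊥](J(A^{-1})^T). -/
open Matrix
open scoped Pointwise

/-- The matrix-product code `[C_1, …, C_s]A`, a subspace of `F^{l·n}`: the codeword
corresponding to `(c_1,…,c_s)` has `(j,k)` entry `∑ i, A i j * (c i) k`. -/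
noncomputable def matrixProdCode {F : Type*} [Field F] {n s l : ℕ}
    (C : Fin s → Submodule F (Fin n → F)) (A : Matrix (Fin s) (Fin l) F) :
    Submodule F (Fin l × Fin n → F) :=
  Submodule.map
    (show (Fin s → Fin n → F) →ₗ[F] (Fin l × Fin n → F) from
      { toFun := fun c (jk : Fin l × Fin n) => ∑ i, A i jk.1 * c i jk.2
        map_add' := by
          intro a b; funext jk
          simp [mul_add, Finset.sum_add_distrib]
        map_smul' := by
          intro r a; funext jk
          simp [Finset.mul_sum, mul_left_comm] })
    (Submodule.pi Set.univ C)

/-- Dual code w.r.t. the standard inner product. -/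
def dualCode {F : Type*} [Field F] {ι : Type*} [Fintype ι] (C : Submodule F (ι → F)) :
    Submodule F (ι → F) where
  carrier := {x | ∀ c ∈ C, ∑ i, x i * c i = 0}
  zero_mem' := by intro c hc; simp
  add_mem' := by
    intro a b ha hb c hc
    simp only [Pi.add_apply, add_mul, Finset.sum_add_distrib, ha c hc, hb c hc, add_zero]
  smul_mem' := by
    intro r x hx c hc
    simp only [Pi.smul_apply, smul_eq_mul, mul_assoc, ← Finset.mul_sum, hx c hc, mul_zero]

theorem mem_matrixProdCode {F : Type*} [Field F] {n s l : ℕ}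
    {C : Fin s → Submodule F (Fin n → F)} {A : Matrix (Fin s) (Fin l) F}
    {x : Fin l × Fin n → F} :
    x ∈ matrixProdCode C A ↔
      ∃ c : Matrix (Fin s) (Fin n) F, (∀ i, c i ∈ C i) ∧ Aᵀ * c = of (Function.curry x) := by
  simp only [matrixProdCode, Submodule.mem_map, Submodule.mem_pi, Set.mem_univ, true_imp_iff]
  refine exists_congr fun c => and_congr_right fun _ => ?_
  simp only [← Matrix.ext_iff, funext_iff, Prod.forall]
  rfl

/-- A word is orthogonal to `[C_1, …, C_s]A` iff each row of `A * x` is orthogonal to the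
corresponding `C_i`. -/
theorem mem_dualCode_matrixProdCode {F : Type*} [Field F] {n s l : ℕ}
    {C : Fin s → Submodule F (Fin n → F)} {A : Matrix (Fin s) (Fin l) F}
    {x : Fin l × Fin n → F} :
    x ∈ dualCode (matrixProdCode C A) ↔
      ∀ i, (A * of (Function.curry x)) i ∈ dualCode (C i) := by
  have inner_eq (c : Matrix (Fin s) (Fin n) F) :
      ∑ jk : Fin l × Fin n, x jk * (Aᵀ * c) jk.1 jk.2 =
        ∑ i, ∑ k, (A * of (Function.curry x)) i k * c i k := by
    simp only [Fintype.sum_prod_type, mul_apply, transpose_apply, of_apply, Function.curry_apply,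
      Finset.mul_sum, Finset.sum_mul]
    rw [Finset.sum_comm_cycle]
    refine Finset.sum_congr rfl fun i _ => ?_
    rw [Finset.sum_comm]
    exact Finset.sum_congr rfl fun k _ => Finset.sum_congr rfl fun j _ => by ring
  constructor
  · intro hx i v hv
    have h := hx (fun jk => (Aᵀ * of (Pi.single i v)) jk.1 jk.2)
      (mem_matrixProdCode.2 ⟨of (Pi.single i v), fun i' => ?_, rfl⟩)
    · rw [inner_eq, Finset.sum_eq_single i] at h
      · simpa using h
      · intro i' _ hi'
        simp [Pi.single_eq_of_ne hi']
      · simp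
    · obtain rfl | hi' := eq_or_ne i' i
      · change (Pi.single i' v : Fin s → Fin n → F) i' ∈ C i'
        rwa [Pi.single_eq_same]
      · change (Pi.single i v : Fin s → Fin n → F) i' ∈ C i'
        rw [Pi.single_eq_of_ne hi']
        exact zero_mem _
  · intro hx y hy
    obtain ⟨c, hc, hcy⟩ := mem_matrixProdCode.1 hy
    have hy' : y = fun jk => (Aᵀ * c) jk.1 jk.2 := by rw [hcy]; rfl
    rw [hy', inner_eq]
    exact Finset.sum_eq_zero fun i _ => hx i _ (hc i)

/-- Left multiplication by the anti-diagonal permutation matrix reverses the order of the rows. -/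
theorem antidiagonal_mul {R : Type*} [NonAssocSemiring R] {s : ℕ} {m : Type*}
    (M : Matrix (Fin s) m R) :
    (Matrix.of fun i j : Fin s => if (i : ℕ) + (j : ℕ) = s - 1 then (1 : R) else 0) * M =
      M.submatrix Fin.rev id := by
  ext i j
  have h (k : Fin s) : (i : ℕ) + (k : ℕ) = s - 1 ↔ i.rev = k := by
    rw [Fin.ext_iff, Fin.val_rev]
    omega
  simp [mul_apply, h]

/-- If `A` is an invertible `s × s` matrix and `J` is the `s × s`
anti-diagonal permutation matrix, then the dual of the matrix-product code
`[C_1,…,C_s]A` is `[C_s^⊥, C_{s-1}^⊥, …, C_1^⊥](J(A⁻¹)ᵀ)`. -/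
theorem dual_matrixProdCode_reversed
    {F : Type*} [Field F] [Fintype F] {n s : ℕ}
    (C : Fin s → Submodule F (Fin n → F))
    (A : Matrix (Fin s) (Fin s) F) (hA : IsUnit A) :
    dualCode (matrixProdCode C A) =
      matrixProdCode (fun i => dualCode (C i.rev))
        ((Matrix.of fun i j : Fin s => if (i : ℕ) + (j : ℕ) = s - 1 then (1 : F) else 0) *
          A⁻¹ᵀ) := by
  have hdet : IsUnit A.det := (isUnit_iff_isUnit_det A).1 hA
  ext x
  rw [mem_dualCode_matrixProdCode, mem_matrixProdCode, antidiagonal_mul]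
  have encode (c : Matrix (Fin s) (Fin n) F) :
      (A⁻¹ᵀ.submatrix Fin.rev id)ᵀ * c = A⁻¹ * c.submatrix Fin.rev id := by
    ext j k
    simp only [mul_apply, transpose_apply, submatrix_apply, id_eq]
    exact Fintype.sum_equiv Fin.revPerm _ _ fun i => by simp
  simp only [encode]
  constructor
  · intro hx
    refine ⟨(A * of (Function.curry x)).submatrix Fin.rev id, fun i => hx i.rev, ?_⟩
    rw [submatrix_submatrix, Fin.rev_involutive.comp_self, Function.comp_id, submatrix_id_id,
      nonsing_inv_mul_cancel_left _ _ hdet]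
  · rintro ⟨d, hd, hdx⟩ i
    rw [← hdx, mul_nonsing_inv_cancel_left _ _ hdet]
    have h := hd i.rev
    rw [Fin.rev_rev] at h
    exact h
end

section
/- Let C_1, C_2 ⊆ F_q^n be linear codes with C_2 ⊆ C_1, let A be the 2×2 matrix with rows (1,1) and (0,1) over F_q, and set C = [C_1, C_2]A. Then the square of C satisfies C^{*2} = [C_1^{*2}, C_1*C_2]A, and its minimum distance satisfies d(C^{*2}) = min{2 d(C_1^{*2}), d(C_1*C_2)}. -/
open scoped Pointwise

/-- Hamming weight of a vector. -/
noncomputable def wt {ι F : Type*} [Fintype ι] [Zero F] (x : ι → F) : ℕ :=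
  letI := Classical.decEq F
  (Finset.univ.filter fun i => x i ≠ 0).card

/-- Minimum distance (= minimum weight) of a code given as a set. -/
noncomputable def minDist {ι F : Type*} [Fintype ι] [Zero F] (C : Set (ι → F)) : ℕ :=
  sInf (wt '' {x ∈ C | x ≠ 0})

/-- Componentwise (Schur) product of two codes. -/
def schurProd {F : Type*} [Field F] {ι : Type*} (C C' : Submodule F (ι → F)) :
    Submodule F (ι → F) :=
  Submodule.span F {x | ∃ c ∈ C, ∃ c' ∈ C', x = c * c'}

theorem wt_eq_sum {ι F : Type*} [Fintype ι] [Zero F] [DecidableEq F] (x : ι → F) :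
    wt x = ∑ i, if x i ≠ 0 then 1 else 0 := by
  rw [wt, Finset.card_filter]
  exact Finset.sum_congr rfl fun i _ => by congr

theorem wt_zero {ι F : Type*} [Fintype ι] [Zero F] : wt (0 : ι → F) = 0 := by
  simp [wt]

theorem wt_prod_fin_two {F : Type*} [Zero F] {n : ℕ} (z : Fin 2 × Fin n → F) :
    wt z = wt (fun k => z (0, k)) + wt (fun k => z (1, k)) := by
  classical
  simp only [wt_eq_sum, Fintype.sum_prod_type, Fin.sum_univ_two]

theorem wt_le_add_wt_add {ι F : Type*} [Fintype ι] [AddGroup F] (x y : ι → F) :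
    wt y ≤ wt x + wt (x + y) := by
  classical
  simp only [wt_eq_sum, ← Finset.sum_add_distrib]
  refine Finset.sum_le_sum fun i _ => ?_
  by_cases hx : x i = 0
  · simp [hx]
  · simp only [ne_eq, hx, not_false_eq_true, if_true]
    split_ifs <;> omega

theorem minDist_le_wt {ι F : Type*} [Fintype ι] [Zero F] {C : Set (ι → F)} {x : ι → F}
    (hx : x ∈ C) (h0 : x ≠ 0) : minDist C ≤ wt x :=
  Nat.sInf_le ⟨x, ⟨hx, h0⟩, rfl⟩

theorem exists_wt_eq_minDist {ι F : Type*} [Fintype ι] [Field F] {C : Submodule F (ι → F)}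
    (hC : C ≠ ⊥) : ∃ x ∈ C, x ≠ 0 ∧ wt x = minDist (C : Set (ι → F)) := by
  obtain ⟨x, hx, h0⟩ := C.exists_mem_ne_zero_of_ne_bot hC
  obtain ⟨y, ⟨hy, hy0⟩, h⟩ := Nat.sInf_mem (s := wt '' {x ∈ (C : Set (ι → F)) | x ≠ 0})
    ⟨_, x, ⟨hx, h0⟩, rfl⟩
  exact ⟨y, hy, hy0, h⟩

/-- The vector `(x, x + y)`, linearly in `(x, y)`. -/
def uuv (F : Type*) [Field F] (n : ℕ) :
    (Fin n → F) × (Fin n → F) →ₗ[F] (Fin 2 × Fin n → F) where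
  toFun p jk := ![p.1 jk.2, p.1 jk.2 + p.2 jk.2] jk.1
  map_add' p q := by
    ext ⟨j, k⟩
    fin_cases j <;> simp [add_add_add_comm]
  map_smul' r p := by
    ext ⟨j, k⟩
    fin_cases j <;> simp [mul_add]

section
variable {F : Type*} [Field F] {n : ℕ}

@[simp] theorem uuv_apply_zero (p : (Fin n → F) × (Fin n → F)) (k : Fin n) :
    uuv F n p (0, k) = p.1 k := rfl

@[simp] theorem uuv_apply_one (p : (Fin n → F) × (Fin n → F)) (k : Fin n) :
    uuv F n p (1, k) = p.1 k + p.2 k := rfl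

theorem uuv_mul (a b a' b' : Fin n → F) :
    uuv F n (a, b) * uuv F n (a', b') = uuv F n (a * a', a * b' + a' * b + b * b') := by
  ext ⟨j, k⟩
  fin_cases j
  · simp
  · simp
    ring

theorem wt_uuv (x y : Fin n → F) : wt (uuv F n (x, y)) = wt x + wt (x + y) :=
  wt_prod_fin_two _

theorem uuv_ne_zero {x y : Fin n → F} (h : x ≠ 0 ∨ y ≠ 0) : uuv F n (x, y) ≠ 0 := by
  intro h0
  have hx : x = 0 := funext fun k => congrFun h0 (0, k)
  subst hx
  have hy : y = 0 := funext fun k => by simpa using congrFun h0 (1, k)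
  simp [hy] at h

theorem matrixProdCode_uuv (D₁ D₂ : Submodule F (Fin n → F)) :
    matrixProdCode ![D₁, D₂] !![(1 : F), 1; 0, 1] = (D₁.prod D₂).map (uuv F n) := by
  ext z
  simp only [matrixProdCode, Submodule.mem_map]
  constructor
  · rintro ⟨c, hc, rfl⟩
    refine ⟨(c 0, c 1), ⟨hc 0 trivial, hc 1 trivial⟩, ?_⟩
    ext ⟨j, k⟩
    fin_cases j <;> simp
  · rintro ⟨⟨x, y⟩, ⟨hx, hy⟩, rfl⟩
    refine ⟨![x, y], fun i _ => by fin_cases i <;> assumption, ?_⟩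
    ext ⟨j, k⟩
    fin_cases j <;> simp

theorem mul_mem_schurProd {ι : Type*} {C C' : Submodule F (ι → F)} {c c' : ι → F}
    (hc : c ∈ C) (hc' : c' ∈ C') : c * c' ∈ schurProd C C' :=
  Submodule.subset_span ⟨c, hc, c', hc', rfl⟩

theorem schurProd_ne_bot_of_le {ι : Type*} {C C' : Submodule F (ι → F)} (hC' : C' ≠ ⊥)
    (h : C' ≤ C) : schurProd C C' ≠ ⊥ := by
  obtain ⟨x, hx, h0⟩ := C'.exists_mem_ne_zero_of_ne_bot hC'
  refine (Submodule.ne_bot_iff _).2 ⟨x * x, mul_mem_schurProd (h hx) hx, fun hxx => h0 ?_⟩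
  ext k
  exact mul_self_eq_zero.1 (congrFun hxx k)

theorem schurProd_map_uuv {C₁ C₂ : Submodule F (Fin n → F)} (h : C₂ ≤ C₁) :
    schurProd ((C₁.prod C₂).map (uuv F n)) ((C₁.prod C₂).map (uuv F n)) =
      ((schurProd C₁ C₁).prod (schurProd C₁ C₂)).map (uuv F n) := by
  apply le_antisymm
  · refine Submodule.span_le.2 ?_
    rintro _ ⟨_, ⟨⟨a, b⟩, ⟨ha, hb⟩, rfl⟩, _, ⟨⟨a', b'⟩, ⟨ha', hb'⟩, rfl⟩, rfl⟩
    rw [uuv_mul]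
    exact Submodule.mem_map_of_mem ⟨mul_mem_schurProd ha ha',
      add_mem (add_mem (mul_mem_schurProd ha hb') (mul_mem_schurProd ha' hb))
        (mul_mem_schurProd (h hb) hb')⟩
  · have hfst : schurProd C₁ C₁ ≤
        (schurProd ((C₁.prod C₂).map (uuv F n)) ((C₁.prod C₂).map (uuv F n))).comap
          (uuv F n ∘ₗ LinearMap.inl F _ _) := by
      refine Submodule.span_le.2 ?_
      rintro _ ⟨a, ha, a', ha', rfl⟩
      have := mul_mem_schurProd (Submodule.mem_map_of_mem (f := uuv F n)
        (show (a, 0) ∈ C₁.prod C₂ from ⟨ha, zero_mem _⟩))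
        (Submodule.mem_map_of_mem (f := uuv F n)
        (show (a', 0) ∈ C₁.prod C₂ from ⟨ha', zero_mem _⟩))
      simpa [uuv_mul] using this
    have hsnd : schurProd C₁ C₂ ≤
        (schurProd ((C₁.prod C₂).map (uuv F n)) ((C₁.prod C₂).map (uuv F n))).comap
          (uuv F n ∘ₗ LinearMap.inr F _ _) := by
      refine Submodule.span_le.2 ?_
      rintro _ ⟨a, ha, b, hb, rfl⟩
      have := mul_mem_schurProd (Submodule.mem_map_of_mem (f := uuv F n)
        (show (a, 0) ∈ C₁.prod C₂ from ⟨ha, zero_mem _⟩))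
        (Submodule.mem_map_of_mem (f := uuv F n)
        (show (0, b) ∈ C₁.prod C₂ from ⟨zero_mem _, hb⟩))
      simpa [uuv_mul] using this
    rintro _ ⟨⟨x, y⟩, ⟨hx, hy⟩, rfl⟩
    have hadd := add_mem (Submodule.mem_comap.1 (hfst hx)) (Submodule.mem_comap.1 (hsnd hy))
    simpa [← map_add] using hadd

theorem minDist_map_uuv {D₁ D₂ : Submodule F (Fin n → F)} (h₁ : D₁ ≠ ⊥) (h₂ : D₂ ≠ ⊥) :
    minDist ((D₁.prod D₂).map (uuv F n) : Set (Fin 2 × Fin n → F)) =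
      min (2 * minDist (D₁ : Set (Fin n → F))) (minDist (D₂ : Set (Fin n → F))) := by
  obtain ⟨x, hx, hx0, hxd⟩ := exists_wt_eq_minDist h₁
  obtain ⟨y, hy, hy0, hyd⟩ := exists_wt_eq_minDist h₂
  have memx : uuv F n (x, 0) ∈ (D₁.prod D₂).map (uuv F n) :=
    Submodule.mem_map_of_mem ⟨hx, zero_mem _⟩
  have memy : uuv F n (0, y) ∈ (D₁.prod D₂).map (uuv F n) :=
    Submodule.mem_map_of_mem ⟨zero_mem _, hy⟩
  apply le_antisymm
  · refine le_min ((minDist_le_wt memx (uuv_ne_zero (.inl hx0))).trans ?_)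
      ((minDist_le_wt memy (uuv_ne_zero (.inr hy0))).trans ?_)
    · rw [wt_uuv, add_zero, hxd, two_mul]
    · rw [wt_uuv, zero_add, wt_zero, zero_add, hyd]
  · obtain ⟨_, ⟨⟨u, v⟩, ⟨hu, hv⟩, rfl⟩, hz0, hzd⟩ :=
      exists_wt_eq_minDist ((Submodule.ne_bot_iff _).2 ⟨_, memx, uuv_ne_zero (.inl hx0)⟩)
    rw [← hzd, wt_uuv]
    by_cases hv0 : v = 0
    · subst hv0
      have hu0 : u ≠ 0 := by
        rintro rfl
        exact hz0 (map_zero (uuv F n))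
      have := minDist_le_wt (C := (D₁ : Set (Fin n → F))) hu hu0
      rw [add_zero, ← two_mul]
      exact (min_le_left _ _).trans (Nat.mul_le_mul_left 2 this)
    · exact (min_le_right _ _).trans
        ((minDist_le_wt (C := (D₂ : Set (Fin n → F))) hv hv0).trans (wt_le_add_wt_add u v))

end

/-- For `C = [C_1, C_2]A` with `A = [[1,1],[0,1]]` and nested
(nonzero) constituent codes `C_2 ⊆ C_1`, one has `C^{*2} = [C_1^{*2}, C_1 * C_2]A`
and `d(C^{*2}) = min{2 d(C_1^{*2}), d(C_1 * C_2)}`. -/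
theorem uuv_square_nested
    {F : Type*} [Field F] [Fintype F] {n : ℕ} (C₁ C₂ : Submodule F (Fin n → F))
    (hC₁ : C₁ ≠ ⊥) (hC₂ : C₂ ≠ ⊥) (h : C₂ ≤ C₁) :
    schurProd (matrixProdCode ![C₁, C₂] !![(1 : F), 1; 0, 1])
        (matrixProdCode ![C₁, C₂] !![(1 : F), 1; 0, 1]) =
      matrixProdCode ![schurProd C₁ C₁, schurProd C₁ C₂] !![(1 : F), 1; 0, 1] ∧
    minDist (schurProd (matrixProdCode ![C₁, C₂] !![(1 : F), 1; 0, 1])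
        (matrixProdCode ![C₁, C₂] !![(1 : F), 1; 0, 1]) : Set (Fin 2 × Fin n → F)) =
      min (2 * minDist (schurProd C₁ C₁ : Set (Fin n → F)))
        (minDist (schurProd C₁ C₂ : Set (Fin n → F))) := by
  simp only [matrixProdCode_uuv, schurProd_map_uuv h, true_and]
  exact minDist_map_uuv (schurProd_ne_bot_of_le hC₁ le_rfl) (schurProd_ne_bot_of_le hC₂ h)
end

section
/- Let gcd(n,q) = 1, let I_1, I_2 be unions of q-cyclotomic cosets modulo n, and let C = [C(I_1), C(I_2)]A be the (u,u+v)-construction with constituent cyclic codes C(I_1), C(I_2) (A having rows (1,1),(0,1)). Then the square of C satisfies C^{*2} = [C(I_1 + I_1), C(I_2 + (I_1 ∪ I_2))]A. -/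
open scoped Pointwise

/-- The cyclic code `C(I)` of length `n` over `F` with generating set `I` (where
`β` is a primitive `n`-th root of unity in the algebraic closure of `F`):
codewords are the coefficient vectors `c` whose polynomial `∑ c_k x^k` vanishes at
`β^j` for every `j` outside `I`; equivalently, the code generated by
`g = (x^n-1)/∏_{i∈I}(x-β^i)`. -/
noncomputable def cyclicCode (F : Type*) [Field F] (n : ℕ) [NeZero n]
    (β : AlgebraicClosure F) (I : Set (ZMod n)) : Submodule F (Fin n → F) where
  carrier := {c | ∀ j : ZMod n, j ∉ I →
    ∑ k : Fin n, algebraMap F (AlgebraicClosure F) (c k) * β ^ (j * (k : ZMod n)).val = 0}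
  zero_mem' := by intro j hj; simp
  add_mem' := by
    intro a b ha hb j hj
    simp only [Pi.add_apply, map_add, add_mul, Finset.sum_add_distrib, ha j hj, hb j hj,
      add_zero]
  smul_mem' := by
    intro r c hc j hj
    simp only [Pi.smul_apply, smul_eq_mul, map_mul, mul_assoc, ← Finset.mul_sum, hc j hj,
      mul_zero]

theorem Submodule.map_mul_map_of_mul_eq {F A B : Type*} [Field F] [Semiring A] [Algebra F A]
    [Semiring B] [Algebra F B] {f g h : A →ₗ[F] B}
    (hfg : ∀ x y, f x * g y = h (x * y)) (M N : Submodule F A) :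
    M.map f * N.map g = (M * N).map h := by
  apply le_antisymm
  · rw [Submodule.mul_le]
    rintro _ ⟨x, hx, rfl⟩ _ ⟨y, hy, rfl⟩
    rw [hfg]
    exact Submodule.mem_map_of_mem (Submodule.mul_mem_mul hx hy)
  · rw [Submodule.map_le_iff_le_comap, Submodule.mul_le]
    intro x hx y hy
    rw [Submodule.mem_comap, ← hfg]
    exact Submodule.mul_mem_mul (Submodule.mem_map_of_mem hx) (Submodule.mem_map_of_mem hy)

theorem schurProd_eq_mul {F : Type*} [Field F] {ι : Type*} (C C' : Submodule F (ι → F)) :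
    schurProd C C' = C * C' := by
  rw [schurProd, Submodule.mul_eq_span_mul_set]
  congr 1
  ext x
  simp [Set.mem_mul, eq_comm]

/-- The repetition embedding `u ↦ (u, u)`. -/
def repeatBlock (F : Type*) [Field F] (n : ℕ) : (Fin n → F) →ₗ[F] (Fin 2 × Fin n → F) :=
  LinearMap.funLeft F F Prod.snd

/-- The embedding `v ↦ (0, v)`. -/
def lastBlock (F : Type*) [Field F] (n : ℕ) : (Fin n → F) →ₗ[F] (Fin 2 × Fin n → F) where
  toFun v jk := if jk.1 = 0 then 0 else v jk.2
  map_add' u v := by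
    funext jk
    by_cases h : jk.1 = 0 <;> simp [h]
  map_smul' r v := by
    funext jk
    by_cases h : jk.1 = 0 <;> simp [h]

theorem matrixProdCode_uuv_s14 {F : Type*} [Field F] {n : ℕ} (C₁ C₂ : Submodule F (Fin n → F)) :
    matrixProdCode ![C₁, C₂] !![(1 : F), 1; 0, 1] =
      C₁.map (repeatBlock F n) ⊔ C₂.map (lastBlock F n) := by
  have key (u v : Fin n → F) : (fun jk : Fin 2 × Fin n =>
      ∑ i, !![(1 : F), 1; 0, 1] i jk.1 * (![u, v] : Fin 2 → Fin n → F) i jk.2) =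
      repeatBlock F n u + lastBlock F n v := by
    funext ⟨j, k⟩
    fin_cases j <;> simp [repeatBlock, lastBlock, LinearMap.funLeft]
  ext x
  rw [Submodule.mem_sup]
  constructor
  · rintro ⟨c, hc, rfl⟩
    refine ⟨_, Submodule.mem_map_of_mem (hc 0 trivial), _,
      Submodule.mem_map_of_mem (hc 1 trivial), ?_⟩
    rw [← key]
    funext jk
    simp [Fin.sum_univ_two]
  · rintro ⟨_, ⟨u, hu, rfl⟩, _, ⟨v, hv, rfl⟩, rfl⟩
    refine ⟨![u, v], ?_, key u v⟩
    intro i _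
    fin_cases i
    · exact hu
    · exact hv

theorem schurProd_uuv {F : Type*} [Field F] {n : ℕ} (C₁ C₂ : Submodule F (Fin n → F)) :
    schurProd (matrixProdCode ![C₁, C₂] !![(1 : F), 1; 0, 1])
        (matrixProdCode ![C₁, C₂] !![(1 : F), 1; 0, 1]) =
      matrixProdCode ![C₁ * C₁, C₂ * C₁ ⊔ C₂ * C₂] !![(1 : F), 1; 0, 1] := by
  have hrr (x y : Fin n → F) :
      repeatBlock F n x * repeatBlock F n y = repeatBlock F n (x * y) := rfl
  have hrl (x y : Fin n → F) :
      repeatBlock F n x * lastBlock F n y = lastBlock F n (x * y) := by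
    funext jk
    by_cases h : jk.1 = 0 <;> simp [repeatBlock, lastBlock, LinearMap.funLeft, h]
  have hlr (x y : Fin n → F) :
      lastBlock F n x * repeatBlock F n y = lastBlock F n (x * y) := by
    funext jk
    by_cases h : jk.1 = 0 <;> simp [repeatBlock, lastBlock, LinearMap.funLeft, h]
  have hll (x y : Fin n → F) :
      lastBlock F n x * lastBlock F n y = lastBlock F n (x * y) := by
    funext jk
    by_cases h : jk.1 = 0 <;> simp [lastBlock, h]
  rw [schurProd_eq_mul, matrixProdCode_uuv_s14, matrixProdCode_uuv_s14, Submodule.sup_mul,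
    Submodule.mul_sup, Submodule.mul_sup, Submodule.map_mul_map_of_mul_eq hrr,
    Submodule.map_mul_map_of_mul_eq hrl, Submodule.map_mul_map_of_mul_eq hlr,
    Submodule.map_mul_map_of_mul_eq hll, Submodule.map_sup, mul_comm C₁ C₂, sup_assoc,
    ← sup_assoc (Submodule.map (lastBlock F n) (C₂ * C₁)), sup_idem]

theorem ZMod.sum_fin_cast {M : Type*} [AddCommMonoid M] {n : ℕ} [NeZero n] (f : ZMod n → M) :
    ∑ k : Fin n, f (k : ZMod n) = ∑ x, f x := by
  refine Fintype.sum_bijective (fun k : Fin n => ((k : ℕ) : ZMod n)) ?_ _ _ fun _ => rfl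
  rw [Fintype.bijective_iff_injective_and_card]
  refine ⟨fun a b hab => Fin.ext ?_, by simp [ZMod.card]⟩
  simpa [ZMod.val_cast_of_lt a.2, ZMod.val_cast_of_lt b.2] using congrArg ZMod.val hab

theorem FiniteField.exists_algebraMap_eq_of_pow_card_eq {F K : Type*} [Field F] [Fintype F]
    [Field K] [Algebra F K] {y : K} (hy : y ^ Fintype.card F = y) :
    ∃ a : F, algebraMap F K a = y := by
  have hmonic : (Polynomial.X ^ Fintype.card F - Polynomial.X : Polynomial F).Monic :=
    Polynomial.monic_X_pow_sub (by simpa using Fintype.one_lt_card)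
  have h := Polynomial.prod_multiset_X_sub_C_of_monic_of_roots_card_eq hmonic (by
    rw [FiniteField.roots_X_pow_card_sub_X,
      FiniteField.X_pow_card_sub_X_natDegree_eq F Fintype.one_lt_card]
    rfl)
  rw [FiniteField.roots_X_pow_card_sub_X] at h
  have h' := congrArg (Polynomial.aeval y) h
  change Polynomial.aeval y (∏ a : F, (Polynomial.X - Polynomial.C a)) = _ at h'
  rw [map_prod] at h'
  simp only [map_sub, map_pow, Polynomial.aeval_X, Polynomial.aeval_C, hy, sub_self,
    Finset.prod_eq_zero_iff] at h'
  obtain ⟨a, -, ha⟩ := h'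
  exact ⟨a, (sub_eq_zero.mp ha).symm⟩

theorem AddChar.sum_fin_mul {K : Type*} [Field K] {n : ℕ} [NeZero n] {χ : AddChar (ZMod n) K}
    (hχ : χ.IsPrimitive) (a : ZMod n) :
    ∑ k : Fin n, χ (a * k) = if a = 0 then (n : K) else 0 := by
  rw [ZMod.sum_fin_cast (fun x => χ (a * x))]
  simpa [mul_comm a, ZMod.card] using AddChar.sum_mulShift a hχ

theorem Submodule.le_of_forall_sum_mul_eq_zero {F : Type*} [Field F] {n : ℕ}
    {S T : Submodule F (Fin n → F)}
    (h : ∀ w : Fin n → F, (∀ s ∈ S, ∑ k, w k * s k = 0) → ∀ d ∈ T, ∑ k, w k * d k = 0) :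
    T ≤ S := by
  intro d hd
  by_contra hdS
  obtain ⟨f, hf, hS⟩ := Submodule.exists_le_ker_of_notMem hdS
  have hsum (x : Fin n → F) : f x = ∑ k, f (Pi.single k 1) * x k := by
    rw [LinearMap.pi_apply_eq_sum_univ f x]
    refine Finset.sum_congr rfl fun k _ => ?_
    rw [smul_eq_mul, mul_comm]
    congr 2
    funext j
    simp [Pi.single_apply, eq_comm]
  refine hf ?_
  rw [hsum]
  refine h _ (fun s hs => ?_) d hd
  rw [← hsum]
  exact hS hs

/-- Fourier inversion on `ZMod n`, with coordinates indexed by `Fin n`. -/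
theorem AddChar.sum_fourier_mul {K : Type*} [Field K] {n : ℕ} [NeZero n]
    {χ : AddChar (ZMod n) K}
    (hχ : χ.IsPrimitive) (d : Fin n → K) (k : Fin n) :
    ∑ j : ZMod n, (∑ l : Fin n, d l * χ (j * l)) * χ (-(j * k)) = n * d k := by
  have hinner (l : Fin n) : ∑ j : ZMod n, χ (j * ((l : ZMod n) - k)) =
      if l = k then (n : K) else 0 := by
    rw [AddChar.sum_mulShift _ hχ]
    have : ((l : ZMod n) - k = 0) ↔ l = k := by
      rw [sub_eq_zero]
      refine ⟨fun hlk => Fin.ext ?_, fun hlk => by rw [hlk]⟩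
      simpa [ZMod.val_cast_of_lt l.2, ZMod.val_cast_of_lt k.2] using congrArg ZMod.val hlk
    simp [this, ZMod.card]
  calc _ = ∑ l : Fin n, d l * ∑ j : ZMod n, χ (j * ((l : ZMod n) - k)) := by
        simp only [Finset.sum_mul, Finset.mul_sum]
        rw [Finset.sum_comm]
        refine Finset.sum_congr rfl fun l _ => Finset.sum_congr rfl fun j _ => ?_
        rw [mul_assoc, ← AddChar.map_add_eq_mul]
        ring_nf
    _ = n * d k := by simp [hinner, mul_comm]

theorem FiniteField.natCast_ne_zero_of_coprime_card {F : Type*} [Field F] [Fintype F]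
    {n : ℕ} (hn : Nat.Coprime n (Fintype.card F)) :
    (n : F) ≠ 0 := by
  have := hn.cast (R := F)
  rw [FiniteField.cast_card_eq_zero, isCoprime_zero_right] at this
  exact this.ne_zero

section CyclicCode

variable {F : Type*} [Field F] {n : ℕ} [NeZero n] {β : AlgebraicClosure F}

theorem mem_cyclicCode_iff_zmodChar (hβ : β ^ n = 1) {I : Set (ZMod n)} {c : Fin n → F} :
    c ∈ cyclicCode F n β I ↔ ∀ j ∉ I,
      ∑ k : Fin n, algebraMap F (AlgebraicClosure F) (c k) *
        AddChar.zmodChar n hβ (j * (k : ZMod n)) = 0 :=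
  Iff.rfl

theorem cyclicCode_mono {I J : Set (ZMod n)} (h : I ⊆ J) :
    cyclicCode F n β I ≤ cyclicCode F n β J :=
  fun _ hc j hj => hc j fun hi => hj (h hi)

theorem cyclicCode_mul_le (hn : (n : F) ≠ 0) (hβ : IsPrimitiveRoot β n) (I J : Set (ZMod n)) :
    cyclicCode F n β I * cyclicCode F n β J ≤ cyclicCode F n β (I + J) := by
  have hχ := AddChar.zmodChar_primitive_of_primitive_root n hβ
  have hnK : (n : AlgebraicClosure F) ≠ 0 := by
    simpa using (map_ne_zero (algebraMap F (AlgebraicClosure F))).mpr hn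
  rw [Submodule.mul_le]
  intro c hc c' hc'
  rw [mem_cyclicCode_iff_zmodChar hβ.pow_eq_one] at hc hc' ⊢
  set χ := AddChar.zmodChar n hβ.pow_eq_one
  intro m hm
  refine (mul_eq_zero.mp ?_).resolve_left hnK
  calc _ = ∑ j : ZMod n, (∑ l : Fin n, algebraMap F (AlgebraicClosure F) (c l) * χ (j * l)) *
        ∑ k : Fin n, algebraMap F (AlgebraicClosure F) (c' k) * χ ((m - j) * k) := by
        simp only [Finset.mul_sum (Finset.univ : Finset (Fin n))]
        rw [Finset.sum_comm]
        refine Finset.sum_congr rfl fun k _ => ?_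
        rw [Pi.mul_apply, map_mul, mul_assoc, ← mul_assoc,
          ← AddChar.sum_fourier_mul hχ (fun l => algebraMap F (AlgebraicClosure F) (c l)),
          Finset.sum_mul]
        refine Finset.sum_congr rfl fun j _ => ?_
        rw [show (m - j) * (k : ZMod n) = -(j * k) + m * k by ring, AddChar.map_add_eq_mul]
        ring
    _ = 0 := by
        refine Finset.sum_eq_zero fun j _ => ?_
        by_cases hj : j ∈ I
        · rw [hc' (m - j) fun h => hm ⟨j, hj, m - j, h, by simp⟩, mul_zero]
        · rw [hc j hj, zero_mul]

variable [Fintype F]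

/-- Over the algebraic closure, `C(I)` spans the characters `k ↦ β ^ (-i k)` with `i ∈ I`:
every functional vanishing on `C(I)` vanishes on them. -/
theorem sum_mul_zmodChar_neg_eq_zero (hn : Nat.Coprime n (Fintype.card F))
    (hβ : IsPrimitiveRoot β n) {I : Set (ZMod n)}
    (hI : ∀ a ∈ I, (Fintype.card F : ZMod n) * a ∈ I) {w : Fin n → AlgebraicClosure F}
    (hw : ∀ c ∈ cyclicCode F n β I, ∑ k, w k * algebraMap F (AlgebraicClosure F) (c k) = 0)
    {i : ZMod n} (hi : i ∈ I) :
    ∑ k : Fin n, w k * AddChar.zmodChar n hβ.pow_eq_one (-(i * (k : ZMod n))) = 0 := by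
  classical
  have hχ := AddChar.zmodChar_primitive_of_primitive_root n hβ
  have hnK : (n : AlgebraicClosure F) ≠ 0 := by
    simpa using (map_ne_zero (algebraMap F (AlgebraicClosure F))).mpr
      (FiniteField.natCast_ne_zero_of_coprime_card hn)
  have hmem (c : Fin n → F) := mem_cyclicCode_iff_zmodChar hβ.pow_eq_one (I := I) (c := c)
  set χ := AddChar.zmodChar n hβ.pow_eq_one
  let u : (ZMod n)ˣ := ZMod.unitOfCoprime (Fintype.card F) hn.symm
  let H := Subgroup.zpowers u
  have hHI (h : H) : ((h : (ZMod n)ˣ) : ZMod n) * i ∈ I := by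
    obtain ⟨s, hs⟩ := mem_powers_iff_mem_zpowers.mpr h.2
    rw [← hs]
    clear hs
    induction s with
    | zero => simpa using hi
    | succ s ih =>
      have := hI _ ih
      simpa [u, pow_succ', mul_assoc] using this
  let y (t : ZMod n) (k : Fin n) : AlgebraicClosure F :=
    ∑ h : H, χ (((h : (ZMod n)ˣ) : ZMod n) * (t - i * k))
  have hy (t : ZMod n) (k : Fin n) : y t k ^ Fintype.card F = y t k := by
    change FiniteField.frobeniusAlgHom F (AlgebraicClosure F) (y t k) = y t k
    rw [map_sum]
    refine Fintype.sum_equiv (Equiv.mulLeft (⟨u, Subgroup.mem_zpowers u⟩ : H)) _ _ fun h => ?_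
    rw [FiniteField.frobeniusAlgHom_apply, ← AddChar.map_nsmul_eq_pow]
    simp [u, mul_assoc]
  choose c hc using fun t k => FiniteField.exists_algebraMap_eq_of_pow_card_eq (hy t k)
  have hcI (t : ZMod n) : c t ∈ cyclicCode F n β I := by
    rw [hmem]
    intro j hj
    simp only [hc, y, Finset.sum_mul]
    rw [Finset.sum_comm]
    refine Finset.sum_eq_zero fun h _ => ?_
    have hne : j - ((h : (ZMod n)ˣ) : ZMod n) * i ≠ 0 := fun h0 =>
      hj (sub_eq_zero.mp h0 ▸ hHI h)
    calc _ = χ (((h : (ZMod n)ˣ) : ZMod n) * t) *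
          ∑ k : Fin n, χ ((j - ((h : (ZMod n)ˣ) : ZMod n) * i) * k) := by
          rw [Finset.mul_sum]
          refine Finset.sum_congr rfl fun k _ => ?_
          rw [← AddChar.map_add_eq_mul, ← AddChar.map_add_eq_mul]
          ring_nf
      _ = 0 := by rw [AddChar.sum_fin_mul hχ, if_neg hne, mul_zero]
  have hinv (k : Fin n) : ∑ t : ZMod n, χ (-t) * y t k = n * χ (-(i * k)) := by
    calc _ = ∑ h : H, χ (-(((h : (ZMod n)ˣ) : ZMod n) * (i * k))) *
          ∑ t : ZMod n, χ (t * (((h : (ZMod n)ˣ) : ZMod n) - 1)) := by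
          simp only [y, Finset.mul_sum]
          rw [Finset.sum_comm]
          refine Finset.sum_congr rfl fun h _ => Finset.sum_congr rfl fun t _ => ?_
          rw [← AddChar.map_add_eq_mul, ← AddChar.map_add_eq_mul]
          ring_nf
      _ = n * χ (-(i * k)) := by
          rw [Finset.sum_eq_single (1 : H)]
          · rw [AddChar.sum_mulShift _ hχ]
            simp [ZMod.card, mul_comm]
          · intro h _ hne
            rw [AddChar.sum_mulShift _ hχ, if_neg, Nat.cast_zero, mul_zero]
            rw [sub_eq_zero]
            exact fun h1 => hne (Subtype.ext (Units.ext h1))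
          · simp
  refine (mul_eq_zero.mp ?_).resolve_left hnK
  calc _ = ∑ t : ZMod n, χ (-t) * ∑ k, w k * algebraMap F (AlgebraicClosure F) (c t k) := by
        simp only [Finset.mul_sum (Finset.univ : Finset (Fin n)), hc]
        rw [Finset.sum_comm]
        refine Finset.sum_congr rfl fun k _ => ?_
        rw [mul_left_comm, ← hinv, Finset.mul_sum]
        exact Finset.sum_congr rfl fun t _ => mul_left_comm _ _ _
    _ = 0 := Finset.sum_eq_zero fun t _ => by rw [hw _ (hcI t), mul_zero]

theorem cyclicCode_le_of_forall (hn : Nat.Coprime n (Fintype.card F))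
    (hβ : IsPrimitiveRoot β n) {I : Set (ZMod n)} {S : Submodule F (Fin n → F)}
    (h : ∀ w : Fin n → F, (∀ s ∈ S, ∑ k, w k * s k = 0) → ∀ i ∈ I,
      ∑ k : Fin n, algebraMap F (AlgebraicClosure F) (w k) *
        AddChar.zmodChar n hβ.pow_eq_one (-(i * (k : ZMod n))) = 0) :
    cyclicCode F n β I ≤ S := by
  have hχ := AddChar.zmodChar_primitive_of_primitive_root n hβ
  have hnK : (n : AlgebraicClosure F) ≠ 0 := by
    simpa using (map_ne_zero (algebraMap F (AlgebraicClosure F))).mpr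
      (FiniteField.natCast_ne_zero_of_coprime_card hn)
  refine Submodule.le_of_forall_sum_mul_eq_zero fun w hw d hd => ?_
  replace h := h w hw
  rw [mem_cyclicCode_iff_zmodChar hβ.pow_eq_one] at hd
  set χ := AddChar.zmodChar n hβ.pow_eq_one
  apply (algebraMap F (AlgebraicClosure F)).injective
  rw [map_zero, map_sum]
  refine (mul_eq_zero.mp ?_).resolve_left hnK
  calc _ = ∑ j : ZMod n, (∑ l : Fin n, algebraMap F (AlgebraicClosure F) (d l) * χ (j * l)) *
        ∑ k : Fin n, algebraMap F (AlgebraicClosure F) (w k) * χ (-(j * k)) := by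
        simp only [Finset.mul_sum (Finset.univ : Finset (Fin n))]
        rw [Finset.sum_comm]
        refine Finset.sum_congr rfl fun k _ => ?_
        rw [map_mul, mul_left_comm,
          ← AddChar.sum_fourier_mul hχ (fun l => algebraMap F (AlgebraicClosure F) (d l)),
          Finset.mul_sum]
        exact Finset.sum_congr rfl fun j _ => mul_left_comm _ _ _
    _ = 0 := by
        refine Finset.sum_eq_zero fun j _ => ?_
        by_cases hj : j ∈ I
        · rw [h j hj, mul_zero]
        · rw [hd j hj, zero_mul]

theorem cyclicCode_add (hn : Nat.Coprime n (Fintype.card F)) (hβ : IsPrimitiveRoot β n)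
    {I J : Set (ZMod n)} (hI : ∀ a ∈ I, (Fintype.card F : ZMod n) * a ∈ I)
    (hJ : ∀ a ∈ J, (Fintype.card F : ZMod n) * a ∈ J) :
    cyclicCode F n β (I + J) = cyclicCode F n β I * cyclicCode F n β J := by
  refine le_antisymm (cyclicCode_le_of_forall hn hβ ?_)
    (cyclicCode_mul_le (FiniteField.natCast_ne_zero_of_coprime_card hn) hβ I J)
  rintro w hw _ ⟨i, hi, j, hj, rfl⟩
  have hwχ := sum_mul_zmodChar_neg_eq_zero hn hβ hI (w := fun k =>
    algebraMap F (AlgebraicClosure F) (w k) *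
      AddChar.zmodChar n hβ.pow_eq_one (-(j * (k : ZMod n)))) (fun c hc => ?_) hi
  · refine Eq.trans (Finset.sum_congr rfl fun k _ => ?_) hwχ
    rw [mul_assoc, ← AddChar.map_add_eq_mul]
    ring_nf
  · have := sum_mul_zmodChar_neg_eq_zero hn hβ hJ
      (w := fun k => algebraMap F (AlgebraicClosure F) (w k * c k)) (fun c' hc' => ?_) hj
    · refine Eq.trans (Finset.sum_congr rfl fun k _ => ?_) this
      rw [map_mul]
      ring
    · have h0 := congrArg (algebraMap F (AlgebraicClosure F))
        (hw _ (Submodule.mul_mem_mul hc hc'))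
      simpa [mul_assoc] using h0

theorem cyclicCode_union (hn : Nat.Coprime n (Fintype.card F)) (hβ : IsPrimitiveRoot β n)
    {I J : Set (ZMod n)} (hI : ∀ a ∈ I, (Fintype.card F : ZMod n) * a ∈ I)
    (hJ : ∀ a ∈ J, (Fintype.card F : ZMod n) * a ∈ J) :
    cyclicCode F n β (I ∪ J) = cyclicCode F n β I ⊔ cyclicCode F n β J := by
  refine le_antisymm (cyclicCode_le_of_forall hn hβ fun w hw i hi => ?_)
    (sup_le (cyclicCode_mono Set.subset_union_left) (cyclicCode_mono Set.subset_union_right))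
  have hwK (c : Fin n → F) (hc : c ∈ cyclicCode F n β I ⊔ cyclicCode F n β J) :
      ∑ k, algebraMap F (AlgebraicClosure F) (w k) *
        algebraMap F (AlgebraicClosure F) (c k) = 0 := by
    simpa using congrArg (algebraMap F (AlgebraicClosure F)) (hw c hc)
  rcases hi with hi | hi
  · exact sum_mul_zmodChar_neg_eq_zero hn hβ hI
      (fun c hc => hwK c (Submodule.mem_sup_left hc)) hi
  · exact sum_mul_zmodChar_neg_eq_zero hn hβ hJ
      (fun c hc => hwK c (Submodule.mem_sup_right hc)) hi

end CyclicCode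

/-- For unions `I_1, I_2` of `q`-cyclotomic cosets modulo `n`
(`gcd(n,q)=1`) and the `(u,u+v)`-construction `C = [C(I_1), C(I_2)]A`, one has
`C^{*2} = [C(I_1 + I_1), C(I_2 + (I_1 ∪ I_2))]A`. -/
theorem uuv_cyclic_square
    {F : Type*} [Field F] [Fintype F] {n : ℕ} [NeZero n]
    (hn : Nat.Coprime n (Fintype.card F))
    (β : AlgebraicClosure F) (hβ : IsPrimitiveRoot β n)
    (I₁ I₂ : Set (ZMod n))
    (hI₁ : ∀ a ∈ I₁, (Fintype.card F : ZMod n) * a ∈ I₁)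
    (hI₂ : ∀ a ∈ I₂, (Fintype.card F : ZMod n) * a ∈ I₂) :
    schurProd (matrixProdCode ![cyclicCode F n β I₁, cyclicCode F n β I₂] !![(1 : F), 1; 0, 1])
        (matrixProdCode ![cyclicCode F n β I₁, cyclicCode F n β I₂] !![(1 : F), 1; 0, 1]) =
      matrixProdCode
        ![cyclicCode F n β (I₁ + I₁), cyclicCode F n β (I₂ + (I₁ ∪ I₂))]
        !![(1 : F), 1; 0, 1] := by
  have hadd {I J : Set (ZMod n)} (hI : ∀ a ∈ I, (Fintype.card F : ZMod n) * a ∈ I)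
      (hJ : ∀ a ∈ J, (Fintype.card F : ZMod n) * a ∈ J) :
      ∀ a ∈ I + J, (Fintype.card F : ZMod n) * a ∈ I + J := by
    rintro _ ⟨i, hi, j, hj, rfl⟩
    exact ⟨_, hI i hi, _, hJ j hj, (mul_add _ _ _).symm⟩
  rw [schurProd_uuv, Set.add_union, cyclicCode_union hn hβ (hadd hI₂ hI₁) (hadd hI₂ hI₂),
    cyclicCode_add hn hβ hI₁ hI₁, cyclicCode_add hn hβ hI₂ hI₁, cyclicCode_add hn hβ hI₂ hI₂]
end
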